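/- arXiv:2209.00832 — 4 statements merged into one kernel-verified Lean document; each statement's English description precedes it below -/
import Mathlib

section
/- Asymptotic representation theorem for classical LAN models (Theorem 1.1). For each n ∈ ℕ and each h ∈ ℝ^d, let Q_n^h be a probability measure on a measurable space (Ω_n, F_n) with Q_n^h absolutely continuous with respect to Q_n^0. Let J be a d×d real symmetric positive definite matrix, and let Δ_n : Ω_n → ℝ^d be measurable maps such that: (a) for every h ∈ ℝ^d there are measurable R_n^h : Ω_n → ℝ converging to 0 in Q_n^0-probability with the Radon–Nikodym derivative satisfying dQ_n^h/dQ_n^0 = exp( ⟨h, Δ_n⟩ − (1/2)⟨h, J h⟩ + R_n^h ) Q_n^0-almost surely; and (b) the law of Δ_n under Q_n^0 converges weakly to the multivariate Gaussian N(0, J) on ℝ^d. Let T_n : Ω_n → ℝ^s be measurable maps such that for every h ∈ ℝ^d the law of T_n under Q_n^h converges weakly to a probability measure L_h on ℝ^s. Then there exists a Markov kernel κ from ℝ^d to ℝ^s such that for every h ∈ ℝ^d, L_h(B) = ∫_{ℝ^d} κ(x, B) dN(Jh, J)(x) for all Borel sets B ⊆ ℝ^s; equivalently, L_h = (N(Jh,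 J)).bind κ. -/
open MeasureTheory Filter ProbabilityTheory

/-- The multivariate Gaussian probability measure `N(m, J)` on `ℝ^d`, with mean vector `m`
and (symmetric positive definite) covariance matrix `J`, defined via its Lebesgue density. -/
noncomputable def gaussianMeasure (d : ℕ) (m : Fin d → ℝ) (J : Matrix (Fin d) (Fin d) ℝ) :
    Measure (Fin d → ℝ) :=
  volume.withDensity fun x => ENNReal.ofReal
    ((2 * Real.pi) ^ (-(d : ℝ) / 2) * Real.sqrt (J⁻¹).det *
      Real.exp (-(1 / 2) * ∑ i, ∑ j, (x i - m i) * (J⁻¹ i j) * (x j - m j)))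

open scoped ENNReal NNReal Topology BoundedContinuousFunction

section WeakLimits

variable {E F : Type*} [MeasurableSpace E] [MeasurableSpace F]

/-- A sequence of probability measures that converges weakly is tight. -/
lemma isTightMeasureSet_range_of_tendsto [PseudoMetricSpace E] [BorelSpace E]
    [SecondCountableTopology E] [CompleteSpace E] [T2Space E]
    {μs : ℕ → ProbabilityMeasure E} {μ : ProbabilityMeasure E}
    (h : Tendsto μs atTop (𝓝 μ)) :
    IsTightMeasureSet {x | ∃ ν ∈ Set.range μs, (ν : Measure E) = x} :=
  isTightMeasureSet_of_isCompact_closure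
    (h.isCompact_insert_range.closure_of_subset (Set.subset_insert _ _))

/-- A sequence of probability measures on a product whose marginals converge weakly has a weak
limit along some ultrafilter finer than `atTop`. -/
lemma exists_ultrafilter_tendsto_of_tendsto_marginals
    [PseudoMetricSpace E] [BorelSpace E] [SecondCountableTopology E] [CompleteSpace E] [T2Space E]
    [PseudoMetricSpace F] [BorelSpace F] [SecondCountableTopology F] [CompleteSpace F] [T2Space F]
    (νs : ℕ → ProbabilityMeasure (E × F)) {μ : ProbabilityMeasure E} {η : ProbabilityMeasure F}
    (hfst : Tendsto (fun n => (νs n).map measurable_fst.aemeasurable) atTop (𝓝 μ))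
    (hsnd : Tendsto (fun n => (νs n).map measurable_snd.aemeasurable) atTop (𝓝 η)) :
    ∃ (U : Ultrafilter ℕ) (ρ : ProbabilityMeasure (E × F)),
      (U : Filter ℕ) ≤ atTop ∧ Tendsto νs U (𝓝 ρ) ∧ (ρ : Measure (E × F)).fst = μ := by
  have htight : IsTightMeasureSet
      {x | ∃ ν ∈ Set.range νs, (ν : Measure (E × F)) = x} := by
    refine IsTightMeasureSet.prodMk
      ((isTightMeasureSet_range_of_tendsto hfst).subset ?_)
      ((isTightMeasureSet_range_of_tendsto hsnd).subset ?_)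
    · rintro _ ⟨_, ⟨_, ⟨n, rfl⟩, rfl⟩, rfl⟩
      exact ⟨_, ⟨n, rfl⟩, rfl⟩
    · rintro _ ⟨_, ⟨_, ⟨n, rfl⟩, rfl⟩, rfl⟩
      exact ⟨_, ⟨n, rfl⟩, rfl⟩
  let U : Ultrafilter ℕ := Ultrafilter.of atTop
  have hU : (U : Filter ℕ) ≤ atTop := Ultrafilter.of_le _
  obtain ⟨ρ, -, hρ⟩ := (isCompact_closure_of_isTightMeasureSet htight).ultrafilter_le_nhds
    (U.map νs) (le_principal_iff.2 <| mem_map.2 <| univ_mem' fun n => subset_closure ⟨n, rfl⟩)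
  have hρ' : Tendsto νs U (𝓝 ρ) := hρ
  refine ⟨U, ρ, hU, hρ', ?_⟩
  have h := tendsto_nhds_unique
    (ProbabilityMeasure.tendsto_map_of_tendsto_of_continuous νs ρ hρ' continuous_fst)
    (hfst.mono_left hU)
  rw [← h]
  rfl

/-- If two probability measures satisfy `∫ f dμ ≤ ∫ f dν` for all nonnegative bounded continuous
functions `f`, they are equal. -/
lemma eq_of_forall_lintegral_le [TopologicalSpace E] [HasOuterApproxClosed E] [BorelSpace E]
    {μ ν : Measure E} [IsProbabilityMeasure μ] [IsProbabilityMeasure ν]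
    (h : ∀ f : E →ᵇ ℝ≥0, ∫⁻ x, f x ∂μ ≤ ∫⁻ x, f x ∂ν) : μ = ν := by
  refine ext_of_forall_lintegral_eq_of_IsFiniteMeasure fun f => (h f).antisymm ?_
  set g : E →ᵇ ℝ≥0 := BoundedContinuousFunction.const E (nndist f 0) - f
  have hfg (x : E) : (f x : ℝ≥0∞) + g x = nndist f 0 := by
    rw [← ENNReal.coe_add]
    congr 1
    exact add_tsub_cancel_of_le (BoundedContinuousFunction.NNReal.upper_bound f x)
  have hsum (κ : Measure E) [IsProbabilityMeasure κ] :
      ∫⁻ x, f x ∂κ + ∫⁻ x, g x ∂κ = nndist f 0 := by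
    rw [← lintegral_add_left (by fun_prop)]
    simp [hfg]
  have hg : ∫⁻ x, g x ∂μ ≠ ∞ := by
    refine ne_top_of_le_ne_top (ENNReal.coe_ne_top (r := nndist f 0)) ?_
    rw [← hsum μ]
    exact le_add_self
  refine (ENNReal.add_le_add_iff_right hg).1 ?_
  rw [hsum μ, ← hsum ν]
  exact add_le_add_right (h g) _

/-- **Le Cam's third lemma**, one-sided form: if the density of `Q n` with respect to `P n` is
`exp (ℓ (X n) + R n)` with `R n → 0` in probability and `(X n, Y n)` converges weakly to `ρ`
under `P n`, then every weak limit of `Y n` under `Q n` dominates the second marginal of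
`exp ℓ • ρ`. -/
lemma lintegral_mul_exp_le_of_tendsto [TopologicalSpace E] [BorelSpace E]
    [SecondCountableTopology E] [TopologicalSpace F] [BorelSpace F] [SecondCountableTopology F]
    {ι : Type*} {U : Filter ι} [U.NeBot] {Ω : ι → Type*} [∀ n, MeasurableSpace (Ω n)]
    {P Q : ∀ n, Measure (Ω n)} [∀ n, IsProbabilityMeasure (P n)]
    [∀ n, IsProbabilityMeasure (Q n)] (hac : ∀ n, Q n ≪ P n)
    {X : ∀ n, Ω n → E} {Y : ∀ n, Ω n → F} {R : ∀ n, Ω n → ℝ}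
    (hX : ∀ n, Measurable (X n)) (hY : ∀ n, Measurable (Y n)) (hR : ∀ n, Measurable (R n))
    {ℓ : E → ℝ} (hℓ : Continuous ℓ)
    (hR0 : ∀ ε > (0 : ℝ), Tendsto (fun n => P n {ω | ε ≤ |R n ω|}) U (𝓝 0))
    (hdens : ∀ n, ∀ᵐ ω ∂(P n),
      (Q n).rnDeriv (P n) ω = ENNReal.ofReal (Real.exp (ℓ (X n ω) + R n ω)))
    {ρ : Measure (E × F)}
    (hρ : ∀ f : (E × F) →ᵇ ℝ≥0,
      Tendsto (fun n => ∫⁻ ω, f (X n ω, Y n ω) ∂(P n)) U (𝓝 (∫⁻ z, f z ∂ρ)))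
    {L : Measure F} (f : F →ᵇ ℝ≥0)
    (hL : Tendsto (fun n => ∫⁻ ω, f (Y n ω) ∂(Q n)) U (𝓝 (∫⁻ y, f y ∂L))) :
    ∫⁻ z, f z.2 * ENNReal.ofReal (Real.exp (ℓ z.1)) ∂ρ ≤ ∫⁻ y, f y ∂L := by
  let g (k : ℕ) : E →ᵇ ℝ≥0 :=
    BoundedContinuousFunction.mkOfBound
      ⟨fun x => min (Real.exp (ℓ x)).toNNReal k, by fun_prop⟩ k (fun x y => by
        have hle (z : E) : ((min (Real.exp (ℓ z)).toNNReal k : ℝ≥0) : ℝ) ≤ k := by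
          exact_mod_cast min_le_right _ _
        simp only [ContinuousMap.coe_mk, NNReal.dist_eq]
        exact abs_sub_le_of_nonneg_of_le (NNReal.coe_nonneg _) (hle x) (NNReal.coe_nonneg _)
          (hle y))
  have g_apply (k x) : g k x = min (Real.exp (ℓ x)).toNNReal k := rfl
  let G (k : ℕ) : (E × F) →ᵇ ℝ≥0 :=
    f.compContinuous ⟨Prod.snd, continuous_snd⟩ * (g k).compContinuous ⟨Prod.fst, continuous_fst⟩
  have G_apply (k z) : G k z = f z.2 * g k z.1 := rfl
  set C : ℝ≥0 := nndist f 0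
  have hfC (y) : f y ≤ C := BoundedContinuousFunction.NNReal.upper_bound f y
  have truncated (k : ℕ) (ε : ℝ) (hε : 0 < ε) :
      ENNReal.ofReal (Real.exp (-ε)) * ∫⁻ z, G k z ∂ρ ≤ ∫⁻ y, f y ∂L := by
    have pre (n : ι) : ENNReal.ofReal (Real.exp (-ε)) * ∫⁻ ω, G k (X n ω, Y n ω) ∂(P n) ≤
        ∫⁻ ω, f (Y n ω) ∂(Q n) + (C * k : ℝ≥0) * P n {ω | ε ≤ |R n ω|} := by
      have hS : MeasurableSet {ω | ε ≤ |R n ω|} :=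
        measurableSet_le measurable_const (hR n).abs
      have hfY : Measurable fun ω => (f (Y n ω) : ℝ≥0∞) :=
        (f.continuous.measurable.comp (hY n)).coe_nnreal_ennreal
      have hGm : Measurable fun ω => (G k (X n ω, Y n ω) : ℝ≥0∞) :=
        ((G k).continuous.measurable.comp ((hX n).prodMk (hY n))).coe_nnreal_ennreal
      rw [← lintegral_rnDeriv_mul (hac n) hfY.aemeasurable, ← lintegral_const_mul _ hGm,
        ← lintegral_indicator_const hS, ← lintegral_add_right _ (measurable_const.indicator hS)]
      refine lintegral_mono_ae ?_
      filter_upwards [hdens n] with ω hω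
      rw [hω, G_apply]
      by_cases hb : ε ≤ |R n ω|
      · rw [Set.indicator_of_mem (by exact hb)]
        refine le_add_left ?_
        calc ENNReal.ofReal (Real.exp (-ε)) * ((f (Y n ω) * g k (X n ω) : ℝ≥0) : ℝ≥0∞)
            ≤ 1 * ((C * k : ℝ≥0) : ℝ≥0∞) := by
              gcongr
              · rw [← ENNReal.ofReal_one]
                exact ENNReal.ofReal_le_ofReal (Real.exp_le_one_iff.2 (by linarith))
              · exact hfC _
              · exact min_le_right _ _
          _ = _ := one_mul _
      · refine le_add_right ?_
        rw [ENNReal.coe_mul, mul_comm ((f (Y n ω) : ℝ≥0) : ℝ≥0∞), ← mul_assoc]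
        gcongr
        calc ENNReal.ofReal (Real.exp (-ε)) * (g k (X n ω) : ℝ≥0∞)
            ≤ ENNReal.ofReal (Real.exp (-ε)) * ENNReal.ofReal (Real.exp (ℓ (X n ω))) := by
              gcongr
              exact ENNReal.coe_le_coe.2 (min_le_left _ _)
          _ = ENNReal.ofReal (Real.exp (-ε + ℓ (X n ω))) := by
              rw [Real.exp_add, ENNReal.ofReal_mul (Real.exp_pos _).le]
          _ ≤ _ := by
              refine ENNReal.ofReal_le_ofReal (Real.exp_le_exp.2 ?_)
              linarith [neg_abs_le (R n ω)]
    have h1 := ENNReal.Tendsto.const_mul (a := ENNReal.ofReal (Real.exp (-ε))) (hρ (G k))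
      (Or.inr ENNReal.ofReal_ne_top)
    have h2 := hL.add (ENNReal.Tendsto.const_mul (a := ((C * k : ℝ≥0) : ℝ≥0∞)) (hR0 ε hε)
      (Or.inr ENNReal.coe_ne_top))
    simpa using le_of_tendsto_of_tendsto' h1 h2 pre
  have bound (k : ℕ) : ∫⁻ z, G k z ∂ρ ≤ ∫⁻ y, f y ∂L := by
    have hc : Tendsto (fun ε : ℝ => ENNReal.ofReal (Real.exp (-ε)) * ∫⁻ z, G k z ∂ρ)
        (𝓝[>] 0) (𝓝 (ENNReal.ofReal (Real.exp (-0)) * ∫⁻ z, G k z ∂ρ)) := by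
      refine ENNReal.Tendsto.mul_const ?_ (Or.inl (by simp))
      exact ((ENNReal.continuous_ofReal.comp
        (Real.continuous_exp.comp continuous_neg)).tendsto 0).mono_left nhdsWithin_le_nhds
    refine le_of_tendsto (by simpa using hc) ?_
    filter_upwards [self_mem_nhdsWithin] with ε hε using truncated k ε hε
  have lim (z : E × F) : f z.2 * ENNReal.ofReal (Real.exp (ℓ z.1)) =
      liminf (fun k => (G k z : ℝ≥0∞)) atTop := by
    refine (Tendsto.liminf_eq ?_).symm
    refine tendsto_const_nhds.congr' ?_
    obtain ⟨k₀, hk₀⟩ := exists_nat_ge (Real.exp (ℓ z.1)).toNNReal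
    filter_upwards [eventually_ge_atTop k₀] with k hk
    rw [G_apply, g_apply, min_eq_left (hk₀.trans (by exact_mod_cast hk)), ENNReal.coe_mul]
    rfl
  calc ∫⁻ z, f z.2 * ENNReal.ofReal (Real.exp (ℓ z.1)) ∂ρ
      = ∫⁻ z, liminf (fun k => (G k z : ℝ≥0∞)) atTop ∂ρ := lintegral_congr lim
    _ ≤ liminf (fun k => ∫⁻ z, G k z ∂ρ) atTop :=
        lintegral_liminf_le fun k => (G k).continuous.measurable.coe_nnreal_ennreal
    _ ≤ ∫⁻ y, f y ∂L :=
        (liminf_le_liminf (Eventually.of_forall bound)).trans_eq (liminf_const _)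

end WeakLimits

section Gaussian

open Matrix

lemma sum_sum_mul_mul_eq_dotProduct_mulVec {d : ℕ} (u v : Fin d → ℝ)
    (A : Matrix (Fin d) (Fin d) ℝ) :
    ∑ i, ∑ j, u i * A i j * v j = u ⬝ᵥ A *ᵥ v := by
  simp only [dotProduct, mulVec, Finset.mul_sum, mul_assoc]

/-- The log-likelihood ratio of `N(Jh, J)` with respect to `N(0, J)`. -/
noncomputable def gaussianShiftLogLikelihood {d : ℕ} (J : Matrix (Fin d) (Fin d) ℝ)
    (h x : Fin d → ℝ) : ℝ :=
  (∑ i, h i * x i) - (1 / 2) * ∑ i, ∑ j, h i * J i j * h j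

lemma continuous_gaussianShiftLogLikelihood {d : ℕ} (J : Matrix (Fin d) (Fin d) ℝ)
    (h : Fin d → ℝ) : Continuous (gaussianShiftLogLikelihood J h) := by
  unfold gaussianShiftLogLikelihood
  fun_prop

lemma gaussianMeasure_mulVec_eq_withDensity {d : ℕ} {J : Matrix (Fin d) (Fin d) ℝ}
    (hJ : J.PosDef) (hJsymm : J.IsSymm) (h : Fin d → ℝ) :
    gaussianMeasure d (fun i => ∑ j, J i j * h j) J =
      (gaussianMeasure d 0 J).withDensity fun x =>
        ENNReal.ofReal (Real.exp (gaussianShiftLogLikelihood J h x)) := by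
  have hdet : IsUnit J.det := hJ.det_pos.ne'.isUnit
  unfold gaussianMeasure
  rw [← withDensity_mul _ (by fun_prop)
    (by have := continuous_gaussianShiftLogLikelihood J h; fun_prop)]
  congr 1 with x
  rw [Pi.mul_apply, ← ENNReal.ofReal_mul (by positivity), mul_assoc _ (Real.exp _),
    ← Real.exp_add]
  congr 3
  have hm : (fun i => ∑ j, J i j * h j) = J *ᵥ h := rfl
  have key : (x - J *ᵥ h) ⬝ᵥ J⁻¹ *ᵥ (x - J *ᵥ h) =
      x ⬝ᵥ J⁻¹ *ᵥ x - 2 * (h ⬝ᵥ x) + h ⬝ᵥ J *ᵥ h := by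
    have e1 : J⁻¹ *ᵥ (J *ᵥ h) = h := by
      rw [mulVec_mulVec, nonsing_inv_mul _ hdet, one_mulVec]
    have e2 : (J *ᵥ h) ⬝ᵥ J⁻¹ *ᵥ x = h ⬝ᵥ x := by
      rw [← vecMul_transpose, hJsymm.eq, ← dotProduct_mulVec, mulVec_mulVec,
        mul_nonsing_inv _ hdet, one_mulVec]
    rw [mulVec_sub, e1, sub_dotProduct, dotProduct_sub, dotProduct_sub, e2,
      dotProduct_comm x h, dotProduct_comm (J *ᵥ h) h]
    ring
  have s1 := sum_sum_mul_mul_eq_dotProduct_mulVec (x - J *ᵥ h) (x - J *ᵥ h) J⁻¹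
  have s2 := sum_sum_mul_mul_eq_dotProduct_mulVec x x J⁻¹
  have s3 := sum_sum_mul_mul_eq_dotProduct_mulVec h h J
  simp only [Pi.sub_apply] at s1
  simp only [gaussianShiftLogLikelihood, Pi.zero_apply, sub_zero]
  have s4 : ∑ i, h i * x i = h ⬝ᵥ x := rfl
  rw [s2, s3, s4]
  change -(1 / 2) * (∑ i, ∑ j, (x i - (J *ᵥ h) i) * J⁻¹ i j * (x j - (J *ᵥ h) j)) = _
  rw [s1, key]
  ring

/-- The total mass of `gaussianMeasure` does not depend on its mean. -/
lemma gaussianMeasure_univ_eq {d : ℕ} (m : Fin d → ℝ) (J : Matrix (Fin d) (Fin d) ℝ) :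
    gaussianMeasure d m J Set.univ = gaussianMeasure d 0 J Set.univ := by
  simp only [gaussianMeasure, withDensity_apply _ MeasurableSet.univ, Measure.restrict_univ,
    Pi.zero_apply, sub_zero]
  exact lintegral_sub_right_eq_self (μ := (volume : Measure (Fin d → ℝ))) (fun x =>
    ENNReal.ofReal ((2 * Real.pi) ^ (-(d : ℝ) / 2) * Real.sqrt (J⁻¹).det *
      Real.exp (-(1 / 2) * ∑ i, ∑ j, x i * (J⁻¹ i j) * x j))) m

end Gaussian

/-- The composition of a kernel with a reweighted measure is the second marginal of the
correspondingly reweighted joint law. -/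
lemma bind_withDensity_eq_snd_withDensity_compProd {E F : Type*} [MeasurableSpace E]
    [MeasurableSpace F] (μ : Measure E) [SFinite μ] (κ : Kernel E F) [IsSFiniteKernel κ]
    {φ : E → ℝ≥0∞} (hφ : Measurable φ) :
    (μ.withDensity φ).bind κ = ((μ ⊗ₘ κ).withDensity fun z => φ z.1).snd := by
  ext B hB
  have hind : Measurable ((Prod.snd ⁻¹' B).indicator fun z : E × F => φ z.1) :=
    (hφ.comp measurable_fst).indicator (measurable_snd hB)
  rw [Measure.bind_apply hB κ.aemeasurable, Measure.snd_apply hB,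
    withDensity_apply _ (measurable_snd hB), ← lintegral_indicator (measurable_snd hB),
    Measure.lintegral_compProd hind,
    lintegral_withDensity_eq_lintegral_mul _ hφ (κ.measurable_coe hB)]
  refine lintegral_congr fun x => ?_
  have : (fun y => (Prod.snd ⁻¹' B).indicator (fun z : E × F => φ z.1) (x, y)) =
      B.indicator fun _ => φ x := by
    ext y
    by_cases hy : y ∈ B <;> simp [hy]
  rw [this, lintegral_indicator_const hB, Pi.mul_apply]

/-- **Asymptotic representation theorem for classical LAN models** (Theorem 1.1).
If the models `Q n h` are LAN at `0` with central sequence `Δ n` and Fisher information `J`,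
and the statistics `T n` converge in distribution under every local parameter `h` to a limit
law `L h`, then there is a Markov kernel `κ` such that `L h = N(Jh, J).bind κ` for all `h`. -/
theorem classical_asymptotic_representation
    (d s : ℕ) (Ω : ℕ → Type*) [∀ n, MeasurableSpace (Ω n)]
    (Q : ∀ n : ℕ, (Fin d → ℝ) → Measure (Ω n))
    [∀ n h, IsProbabilityMeasure (Q n h)]
    (hac : ∀ n h, Q n h ≪ Q n 0)
    (J : Matrix (Fin d) (Fin d) ℝ) (hJsymm : J.IsSymm) (hJpos : J.PosDef)
    (Δ : ∀ n : ℕ, Ω n → (Fin d → ℝ)) (hΔmeas : ∀ n, Measurable (Δ n))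
    -- (a) LAN expansion of the Radon–Nikodym derivatives
    (hLAN : ∀ h : Fin d → ℝ, ∃ R : ∀ n : ℕ, Ω n → ℝ,
      (∀ n, Measurable (R n)) ∧
      (∀ ε > (0 : ℝ),
        Tendsto (fun n => Q n 0 {ω | ε ≤ |R n ω|}) atTop (nhds 0)) ∧
      (∀ n, ∀ᵐ ω ∂(Q n 0),
        (Q n h).rnDeriv (Q n 0) ω =
          ENNReal.ofReal (Real.exp ((∑ i, h i * Δ n ω i) -
            (1 / 2) * ∑ i, ∑ j, h i * J i j * h j + R n ω))))
    -- (b) the central sequence is asymptotically `N(0, J)` under `Q n 0`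
    (hCLT : ∀ f : BoundedContinuousFunction (Fin d → ℝ) ℝ,
      Tendsto (fun n => ∫ ω, f (Δ n ω) ∂(Q n 0)) atTop
        (nhds (∫ x, f x ∂(gaussianMeasure d 0 J))))
    (T : ∀ n : ℕ, Ω n → (Fin s → ℝ)) (hTmeas : ∀ n, Measurable (T n))
    (L : (Fin d → ℝ) → Measure (Fin s → ℝ)) (hLprob : ∀ h, IsProbabilityMeasure (L h))
    (hTconv : ∀ h : Fin d → ℝ, ∀ f : BoundedContinuousFunction (Fin s → ℝ) ℝ,
      Tendsto (fun n => ∫ ω, f (T n ω) ∂(Q n h)) atTop (nhds (∫ x, f x ∂(L h)))) :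
    ∃ κ : Kernel (Fin d → ℝ) (Fin s → ℝ), IsMarkovKernel κ ∧
      ∀ h : Fin d → ℝ,
        L h = (gaussianMeasure d (fun i => ∑ j, J i j * h j) J).bind fun x => κ x := by
  have hmass : (gaussianMeasure d 0 J).real Set.univ = 1 := by
    have h := hCLT (BoundedContinuousFunction.const _ 1)
    simpa using tendsto_nhds_unique h (by simp)
  have hγ : IsProbabilityMeasure (gaussianMeasure d 0 J) :=
    ⟨by simpa [Measure.real, ENNReal.toReal_eq_one_iff] using hmass⟩
  let γ : ProbabilityMeasure (Fin d → ℝ) := ⟨gaussianMeasure d 0 J, hγ⟩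
  let νs (n : ℕ) : ProbabilityMeasure ((Fin d → ℝ) × (Fin s → ℝ)) :=
    ⟨(Q n 0).map fun ω => (Δ n ω, T n ω),
      Measure.isProbabilityMeasure_map ((hΔmeas n).prodMk (hTmeas n)).aemeasurable⟩
  have hfst : Tendsto (fun n => (νs n).map measurable_fst.aemeasurable) atTop (𝓝 γ) := by
    refine ProbabilityMeasure.tendsto_iff_forall_integral_tendsto.2 fun f => ?_
    refine (hCLT f).congr fun n => ?_
    change _ = ∫ x, f x ∂(((Q n 0).map fun ω => (Δ n ω, T n ω)).map Prod.fst)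
    rw [Measure.map_map measurable_fst ((hΔmeas n).prodMk (hTmeas n)),
      integral_map (by exact (hΔmeas n).aemeasurable) f.continuous.aestronglyMeasurable]
    rfl
  have hsnd : Tendsto (fun n => (νs n).map measurable_snd.aemeasurable) atTop
      (𝓝 (⟨L 0, hLprob 0⟩ : ProbabilityMeasure (Fin s → ℝ))) := by
    refine ProbabilityMeasure.tendsto_iff_forall_integral_tendsto.2 fun f => ?_
    refine (hTconv 0 f).congr fun n => ?_
    change _ = ∫ x, f x ∂(((Q n 0).map fun ω => (Δ n ω, T n ω)).map Prod.snd)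
    rw [Measure.map_map measurable_snd ((hΔmeas n).prodMk (hTmeas n)),
      integral_map (by exact (hTmeas n).aemeasurable) f.continuous.aestronglyMeasurable]
    rfl
  obtain ⟨U, ρ, hU, hρ, hρfst⟩ := exists_ultrafilter_tendsto_of_tendsto_marginals νs hfst hsnd
  refine ⟨(ρ : Measure ((Fin d → ℝ) × (Fin s → ℝ))).condKernel, inferInstance, fun h => ?_⟩
  have hℓ := continuous_gaussianShiftLogLikelihood J h
  have hφ : Measurable fun x => ENNReal.ofReal (Real.exp (gaussianShiftLogLikelihood J h x)) := by
    fun_prop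
  have hφfst : Measurable fun z : (Fin d → ℝ) × (Fin s → ℝ) =>
      ENNReal.ofReal (Real.exp (gaussianShiftLogLikelihood J h z.1)) := hφ.comp measurable_fst
  have hdis : gaussianMeasure d 0 J ⊗ₘ (ρ : Measure ((Fin d → ℝ) × (Fin s → ℝ))).condKernel = ρ := by
    have := (ρ : Measure ((Fin d → ℝ) × (Fin s → ℝ))).disintegrate (ρ : Measure ((Fin d → ℝ) × (Fin s → ℝ))).condKernel
    rwa [hρfst] at this
  have hγh : IsProbabilityMeasure (gaussianMeasure d (fun i => ∑ j, J i j * h j) J) :=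
    ⟨(gaussianMeasure_univ_eq _ J).trans measure_univ⟩
  have hprob := hLprob h
  symm
  refine eq_of_forall_lintegral_le fun f => ?_
  rw [gaussianMeasure_mulVec_eq_withDensity hJpos hJsymm,
    bind_withDensity_eq_snd_withDensity_compProd _ _ hφ, hdis, Measure.snd,
    lintegral_map (by fun_prop) measurable_snd,
    lintegral_withDensity_eq_lintegral_mul _ hφfst (by fun_prop)]
  obtain ⟨R, hRmeas, hR0, hdens⟩ := hLAN h
  have hρ' (g : ((Fin d → ℝ) × (Fin s → ℝ)) →ᵇ ℝ≥0) :
      Tendsto (fun n => ∫⁻ ω, g (Δ n ω, T n ω) ∂(Q n 0)) U (𝓝 (∫⁻ z, g z ∂(ρ : Measure ((Fin d → ℝ) × (Fin s → ℝ))))) := by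
    refine (ProbabilityMeasure.tendsto_iff_forall_lintegral_tendsto.1 hρ g).congr fun n => ?_
    exact lintegral_map g.continuous.measurable.coe_nnreal_ennreal
      ((hΔmeas n).prodMk (hTmeas n))
  have hLlim : Tendsto (fun n => ∫⁻ ω, f (T n ω) ∂(Q n h)) U (𝓝 (∫⁻ y, f y ∂(L h))) := by
    let μs (n : ℕ) : ProbabilityMeasure (Fin s → ℝ) :=
      ⟨(Q n h).map (T n), Measure.isProbabilityMeasure_map (hTmeas n).aemeasurable⟩
    have hμs : Tendsto μs atTop (𝓝 ⟨L h, hprob⟩) := by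
      refine ProbabilityMeasure.tendsto_iff_forall_integral_tendsto.2 fun f => ?_
      refine (hTconv h f).congr fun n => ?_
      exact (integral_map (hTmeas n).aemeasurable f.continuous.aestronglyMeasurable).symm
    refine ((ProbabilityMeasure.tendsto_iff_forall_lintegral_tendsto.1 hμs f).mono_left
      hU).congr fun n => ?_
    exact lintegral_map f.continuous.measurable.coe_nnreal_ennreal (hTmeas n)
  exact (lintegral_congr fun z => mul_comm (ENNReal.ofReal _) _).trans_le
    (lintegral_mul_exp_le_of_tendsto (fun n => hac n h) hΔmeas hTmeas hRmeas hℓ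
      (fun ε hε => (hR0 ε hε).mono_left hU) hdens hρ' f hLlim)
end

section
/- Operator recovery from a dominated positive semidefinite kernel (core of Lemma 3.3). Let H be a complex Hilbert space, D a nonempty set, and ψ : D → H a family of vectors whose complex linear span is dense in H. Define φ_I : D × D → ℂ by φ_I(ξ, η) := ⟨ψ(ξ), ψ(η)⟩. Suppose φ : D × D → ℂ is such that both φ and (ξ, η) ↦ φ_I(ξ, η) − φ(ξ, η) are positive semidefinite kernels. Then there exists a unique bounded linear operator A : H → H such that A is self-adjoint, 0 ≤ ⟨v, A v⟩ ≤ ⟨v, v⟩ for all v ∈ H, and φ(ξ, η) = ⟨ψ(ξ), A ψ(η)⟩ for all ξ, η ∈ D. -/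
open scoped ComplexOrder InnerProductSpace

/-- A function `f : D × D → ℂ` is a positive semidefinite kernel if every finite Gram-type
sum `Σ_{i,j} conj(c i) * c j * f (ξ i) (ξ j)` is a nonnegative real number. -/
def IsPosSemidefKernel {D : Type*} (f : D → D → ℂ) : Prop :=
  ∀ (r : ℕ) (ξ : Fin r → D) (c : Fin r → ℂ),
    0 ≤ ∑ i, ∑ j, (starRingEnd ℂ) (c i) * c j * f (ξ i) (ξ j)

namespace IsPosSemidefKernel

variable {D : Type*} {f : D → D → ℂ}

theorem conj_symm (hf : IsPosSemidefKernel f) (x y : D) :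
    (starRingEnd ℂ) (f y x) = f x y := by
  have hx := (Complex.le_def.1 (hf 1 ![x] ![1])).2
  have hy := (Complex.le_def.1 (hf 1 ![y] ![1])).2
  have h1 := (Complex.le_def.1 (hf 2 ![x, y] ![1, 1])).2
  have hI := (Complex.le_def.1 (hf 2 ![x, y] ![1, Complex.I])).2
  simp [Fin.sum_univ_two] at hx hy h1 hI
  apply Complex.ext
  · simp; linarith
  · simp; linarith

theorem finsuppSum_nonneg (hf : IsPosSemidefKernel f) (c : D →₀ ℂ) :
    0 ≤ c.sum fun x z ↦ c.sum fun y w ↦ (starRingEnd ℂ) z * w * f x y := by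
  let e := c.support.equivFin.symm
  convert hf _ (fun i ↦ (e i : D)) (fun i ↦ c (e i)) using 1
  have h (g : D → ℂ) : ∑ x ∈ c.support, g x = ∑ i, g (e i) := by
    rw [← Finset.sum_coe_sort, ← e.sum_comp]
  simp only [Finsupp.sum, h]

/-- The semi-inner product on finitely supported functions induced by a positive semidefinite
kernel. -/
noncomputable abbrev preInnerCore (hf : IsPosSemidefKernel f) :
    PreInnerProductSpace.Core ℂ (D →₀ ℂ) where
  inner c d := c.sum fun x z ↦ d.sum fun y w ↦ (starRingEnd ℂ) z * w * f x y
  conj_inner_symm c d := by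
    rw [Finsupp.sum_comm]
    simp only [map_finsuppSum]
    congr! 4
    simp [hf.conj_symm, mul_comm]
  add_left _ _ _ := by
    rw [Finsupp.sum_add_index'] <;> simp [← Finsupp.sum_add, add_mul]
  smul_left _ _ _ := by
    rw [Finsupp.sum_smul_index] <;> simp [Finsupp.mul_sum, ← mul_assoc]
  re_inner_nonneg c := (Complex.le_def.1 (hf.finsuppSum_nonneg c)).1

/-- **Kolmogorov decomposition**: a positive semidefinite kernel is a Gram kernel of vectors in
a Hilbert space. -/
theorem exists_inner_eq.{u} {D : Type u} {f : D → D → ℂ} (hf : IsPosSemidefKernel f) :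
    ∃ (K : Type u) (_ : NormedAddCommGroup K) (_ : InnerProductSpace ℂ K) (_ : CompleteSpace K)
      (k : D → K), ∀ x y, ⟪k x, k y⟫_ℂ = f x y := by
  let core := hf.preInnerCore
  let : SeminormedAddCommGroup (D →₀ ℂ) :=
    InnerProductSpace.Core.toSeminormedAddCommGroup (𝕜 := ℂ)
  let : InnerProductSpace ℂ (D →₀ ℂ) := .ofCore core
  refine ⟨UniformSpace.Completion (D →₀ ℂ), inferInstance, inferInstance, inferInstance,
    fun x ↦ ((Finsupp.single x 1 : D →₀ ℂ) : UniformSpace.Completion (D →₀ ℂ)), fun x y ↦ ?_⟩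
  rw [UniformSpace.Completion.inner_coe]
  change (Finsupp.single x 1).sum (fun x z ↦ (Finsupp.single y 1).sum
    fun y w ↦ (starRingEnd ℂ) z * w * f x y) = f x y
  simp

end IsPosSemidefKernel

theorem inner_linearCombination_linearCombination {D E : Type*} [NormedAddCommGroup E]
    [InnerProductSpace ℂ E] (k : D → E) (c d : D →₀ ℂ) :
    ⟪Finsupp.linearCombination ℂ k c, Finsupp.linearCombination ℂ k d⟫_ℂ =
      c.sum fun x z ↦ d.sum fun y w ↦ (starRingEnd ℂ) z * w * ⟪k x, k y⟫_ℂ := by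
  simp only [Finsupp.linearCombination_apply, Finsupp.sum]
  rw [sum_inner]
  refine Finset.sum_congr rfl fun x _ ↦ ?_
  rw [inner_sum]
  refine Finset.sum_congr rfl fun y _ ↦ ?_
  rw [inner_smul_left, inner_smul_right]
  ring

/-- If the Gram kernel of `ψ` dominates that of `k`, and `ψ` spans a dense subspace, then some
contraction maps `ψ` to `k`. -/
theorem exists_contraction_of_dominated {D E K : Type*} [NormedAddCommGroup E]
    [InnerProductSpace ℂ E] [NormedAddCommGroup K] [InnerProductSpace ℂ K] [CompleteSpace K]
    {ψ : D → E} {k : D → K} (hdense : Dense (Submodule.span ℂ (Set.range ψ) : Set E))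
    (hdom : IsPosSemidefKernel fun x y ↦ ⟪ψ x, ψ y⟫_ℂ - ⟪k x, k y⟫_ℂ) :
    ∃ S : E →L[ℂ] K, (∀ v, ‖S v‖ ≤ ‖v‖) ∧ ∀ x, S (ψ x) = k x := by
  have hrange : DenseRange (Finsupp.linearCombination ℂ ψ) := by
    rw [DenseRange, ← LinearMap.coe_range, Finsupp.range_linearCombination]
    exact hdense
  have hnorm (c : D →₀ ℂ) :
      ‖Finsupp.linearCombination ℂ k c‖ ≤ 1 * ‖Finsupp.linearCombination ℂ ψ c‖ := by
    have h := hdom.finsuppSum_nonneg c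
    simp only [mul_sub, Finsupp.sum_sub] at h
    rw [← inner_linearCombination_linearCombination, ← inner_linearCombination_linearCombination,
      inner_self_eq_norm_sq_to_K, inner_self_eq_norm_sq_to_K, sub_nonneg] at h
    rw [one_mul, ← sq_le_sq₀ (norm_nonneg _) (norm_nonneg _)]
    exact_mod_cast h
  refine ⟨(Finsupp.linearCombination ℂ k).extendOfNorm (Finsupp.linearCombination ℂ ψ),
    fun v ↦ ?_, fun x ↦ ?_⟩
  · simpa using LinearMap.norm_extendOfNorm_apply_le hrange 1 hnorm v
  · simpa using LinearMap.extendOfNorm_eq hrange ⟨1, hnorm⟩ (Finsupp.single x 1)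

/-- A bounded operator is determined by its matrix elements on a family with dense span. -/
theorem ContinuousLinearMap.ext_inner_of_dense_span {D E : Type*} [NormedAddCommGroup E]
    [InnerProductSpace ℂ E] {ψ : D → E} (hdense : Dense (Submodule.span ℂ (Set.range ψ) : Set E))
    {A B : E →L[ℂ] E} (h : ∀ x y, ⟪ψ x, A (ψ y)⟫_ℂ = ⟪ψ x, B (ψ y)⟫_ℂ) : A = B := by
  refine ContinuousLinearMap.ext_on hdense ?_
  rintro _ ⟨y, rfl⟩
  refine (innerSL_inj (𝕜 := ℂ)).1 (ContinuousLinearMap.ext_on hdense ?_)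
  rintro _ ⟨x, rfl⟩
  rw [innerSL_apply_apply, innerSL_apply_apply, ← inner_conj_symm, h, inner_conj_symm]

/-- **Operator recovery from a dominated positive semidefinite kernel** (core of Lemma 3.3).
If `φ` and `φ_I − φ` are positive semidefinite kernels, where
`φ_I (ξ, η) = ⟨ψ ξ, ψ η⟩` and the span of the `ψ ξ` is dense, then there is a unique bounded
operator `A` with `0 ≤ A ≤ I` such that `φ (ξ, η) = ⟨ψ ξ, A (ψ η)⟩`. -/
theorem operator_recovery_of_dominated_kernel
    {H : Type*} [NormedAddCommGroup H] [InnerProductSpace ℂ H] [CompleteSpace H]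
    {D : Type*} [Nonempty D] (ψ : D → H)
    (hdense : Dense (Submodule.span ℂ (Set.range ψ) : Set H))
    (φ : D → D → ℂ)
    (hφ : IsPosSemidefKernel φ)
    (hdom : IsPosSemidefKernel (fun ξ η => ⟪ψ ξ, ψ η⟫_ℂ - φ ξ η)) :
    ∃! A : H →L[ℂ] H,
      IsSelfAdjoint A ∧
      (∀ v : H, 0 ≤ ⟪v, A v⟫_ℂ ∧ ⟪v, A v⟫_ℂ ≤ ⟪v, v⟫_ℂ) ∧
      (∀ ξ η : D, φ ξ η = ⟪ψ ξ, A (ψ η)⟫_ℂ) := by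
  obtain ⟨K, _, _, _, k, hk⟩ := hφ.exists_inner_eq
  simp only [← hk] at hdom
  obtain ⟨S, hS, hSψ⟩ := exists_contraction_of_dominated hdense hdom
  refine ⟨S.adjoint ∘L S, ⟨(ContinuousLinearMap.isPositive_adjoint_comp_self S).isSelfAdjoint,
    fun v ↦ ?_, fun ξ η ↦ ?_⟩, fun B hB ↦ ?_⟩
  · rw [ContinuousLinearMap.comp_apply, ContinuousLinearMap.adjoint_inner_right,
      inner_self_eq_norm_sq_to_K, inner_self_eq_norm_sq_to_K]
    have h : ‖S v‖ ^ 2 ≤ ‖v‖ ^ 2 := by gcongr; exact hS v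
    norm_cast
    exact ⟨Complex.zero_le_real.2 (sq_nonneg _), h⟩
  · rw [ContinuousLinearMap.comp_apply, ContinuousLinearMap.adjoint_inner_right, hSψ, hSψ, hk]
  · refine ContinuousLinearMap.ext_inner_of_dense_span hdense fun ξ η ↦ ?_
    rw [← hB.2.2, ContinuousLinearMap.comp_apply, ContinuousLinearMap.adjoint_inner_right,
      hSψ, hSψ, hk]
end

section
/- Uniqueness of the solution of the moment equation (Example 2.1). Let m : ℝ → ℝ be a bounded Borel measurable function such that ∫_ℝ m(x) · (2π)^{−1/2} e^{−(x−h)²/2} dx = e^{−h²/4} for every h ∈ ℝ. Then m(x) = √2 · e^{−x²/2} for Lebesgue-almost every x ∈ ℝ. -/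
open MeasureTheory Real

open ProbabilityTheory in
/-- Finite measures on `ℝ` whose exponential moments are all finite are determined by their
moment-generating functions. -/
theorem measure_ext_of_mgf_id {μ ν : Measure ℝ} [IsFiniteMeasure μ] [IsFiniteMeasure ν]
    (hμ : integrableExpSet id μ = Set.univ) (h : mgf id μ = mgf id ν) : μ = ν := by
  have hzero : μ = 0 ↔ ν = 0 := by
    have h0 := congrFun h 0
    simp only [mgf_zero'] at h0
    rw [← Measure.measure_univ_eq_zero, ← Measure.measure_univ_eq_zero,
      ← measureReal_eq_zero_iff, h0, measureReal_eq_zero_iff]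
  refine Measure.ext_of_complexMGF_id_eq (funext fun z => ?_)
  exact eqOn_complexMGF_of_mgf' h hzero (by simp [hμ])

open ProbabilityTheory in
/-- Bounded nonnegative densities with respect to the standard Gaussian measure are determined by
their exponential moments. -/
theorem ae_eq_gaussianReal_of_integral_exp_eq {f g : ℝ → ℝ} (hf : Measurable f)
    (hg : Measurable g) {K : ℝ} (hf0 : ∀ x, 0 ≤ f x) (hg0 : ∀ x, 0 ≤ g x)
    (hfK : ∀ x, f x ≤ K) (hgK : ∀ x, g x ≤ K)
    (h : ∀ t : ℝ, ∫ x, f x * exp (t * x) ∂gaussianReal 0 1 =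
      ∫ x, g x * exp (t * x) ∂gaussianReal 0 1) :
    f =ᵐ[gaussianReal 0 1] g := by
  have hle : ∀ u : ℝ → ℝ, (∀ x, u x ≤ K) →
      (gaussianReal 0 1).withDensity (fun x => ENNReal.ofReal (u x)) ≤
        ENNReal.ofReal K • gaussianReal 0 1 := fun u hu => by
    rw [← withDensity_const]
    exact withDensity_mono (.of_forall fun x => ENNReal.ofReal_le_ofReal (hu x))
  have hfin : ∀ u : ℝ → ℝ, (∀ x, u x ≤ K) →
      IsFiniteMeasure ((gaussianReal 0 1).withDensity (fun x => ENNReal.ofReal (u x))) :=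
    fun u hu => by
      have := Measure.smul_finite (gaussianReal 0 1) (c := ENNReal.ofReal K) ENNReal.ofReal_ne_top
      exact isFiniteMeasure_of_le _ (hle u hu)
  have := hfin f hfK
  have := hfin g hgK
  have hmgf : ∀ u : ℝ → ℝ, Measurable u → (∀ x, 0 ≤ u x) → ∀ t,
      mgf id ((gaussianReal 0 1).withDensity (fun x => ENNReal.ofReal (u x))) t =
        ∫ x, u x * exp (t * x) ∂gaussianReal 0 1 := fun u hu hu0 t => by
    rw [mgf, integral_withDensity_eq_integral_toReal_smul (by fun_prop) (by simp)]
    simp [ENNReal.toReal_ofReal (hu0 _)]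
  have heq := measure_ext_of_mgf_id
    (μ := (gaussianReal 0 1).withDensity (fun x => ENNReal.ofReal (f x)))
    (ν := (gaussianReal 0 1).withDensity (fun x => ENNReal.ofReal (g x)))
    (Set.eq_univ_of_forall fun t =>
      ((integrable_exp_mul_gaussianReal t).smul_measure ENNReal.ofReal_ne_top).mono_measure
        (hle f hfK))
    (funext fun t => by rw [hmgf f hf hf0, hmgf g hg hg0, h])
  rw [withDensity_eq_iff_of_sigmaFinite (by fun_prop) (by fun_prop)] at heq
  filter_upwards [heq] with x hx
  exact (ENNReal.ofReal_eq_ofReal_iff (hf0 x) (hg0 x)).mp hx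

theorem two_pi_rpow_neg_half : (2 * π) ^ (-(1 : ℝ) / 2) = (√(2 * π))⁻¹ := by
  rw [neg_div, rpow_neg (by positivity), sqrt_eq_rpow]

open ProbabilityTheory in
/-- Completing the square: exponential moments under the standard Gaussian measure are rescaled
integrals against shifted Gaussian densities. -/
theorem integral_mul_exp_gaussianReal (f : ℝ → ℝ) (t : ℝ) :
    ∫ x, f x * exp (t * x) ∂gaussianReal 0 1 =
      exp (t ^ 2 / 2) * ∫ x, f x * ((2 * π) ^ (-(1 : ℝ) / 2) * exp (-(x - t) ^ 2 / 2)) := by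
  rw [integral_gaussianReal_eq_integral_smul one_ne_zero, ← integral_const_mul]
  congr 1 with x
  have hexp : exp (-x ^ 2 / 2) * exp (t * x) = exp (t ^ 2 / 2) * exp (-(x - t) ^ 2 / 2) := by
    rw [← exp_add, ← exp_add]
    ring_nf
  simp only [gaussianPDFReal_def, smul_eq_mul, two_pi_rpow_neg_half, NNReal.coe_one, mul_one,
    sub_zero]
  linear_combination (√(2 * π))⁻¹ * f x * hexp

theorem integrable_exp_neg_sub_sq_div_two (h : ℝ) :
    Integrable fun x : ℝ => (2 * π) ^ (-(1 : ℝ) / 2) * exp (-(x - h) ^ 2 / 2) := by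
  have := ProbabilityTheory.integrable_gaussianPDFReal h 1
  simpa [ProbabilityTheory.gaussianPDFReal_def, two_pi_rpow_neg_half] using this

theorem integral_sqrt_two_mul_exp_mul_gaussian (h : ℝ) :
    ∫ x : ℝ, √2 * exp (-x ^ 2 / 2) * ((2 * π) ^ (-(1 : ℝ) / 2) * exp (-(x - h) ^ 2 / 2)) =
      exp (-h ^ 2 / 4) := by
  have hpt : ∀ x : ℝ,
      √2 * exp (-x ^ 2 / 2) * ((2 * π) ^ (-(1 : ℝ) / 2) * exp (-(x - h) ^ 2 / 2)) =
        (√π)⁻¹ * exp (-h ^ 2 / 4) * exp (-1 * (x - h / 2) ^ 2) := fun x => by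
    have hexp : exp (-x ^ 2 / 2) * exp (-(x - h) ^ 2 / 2) =
        exp (-h ^ 2 / 4) * exp (-1 * (x - h / 2) ^ 2) := by
      rw [← exp_add, ← exp_add]
      ring_nf
    have hsqrt : √2 * (√(2 * π))⁻¹ = (√π)⁻¹ := by
      rw [sqrt_mul (by norm_num)]
      field_simp
    rw [two_pi_rpow_neg_half, mul_assoc (√π)⁻¹, ← hexp, ← hsqrt]
    ring
  simp_rw [hpt]
  rw [integral_const_mul, integral_sub_right_eq_self (fun x => exp (-1 * x ^ 2)),
    integral_gaussian, div_one]
  have : √π ≠ 0 := by positivity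
  field_simp

/-- **Uniqueness of the solution of the moment equation** (Example 2.1).
If a bounded Borel measurable `m : ℝ → ℝ` satisfies
`∫ m(x) (2π)^{-1/2} e^{-(x-h)²/2} dx = e^{-h²/4}` for every `h`, then
`m(x) = √2 e^{-x²/2}` for Lebesgue-almost every `x`. -/
theorem moment_equation_unique (m : ℝ → ℝ) (hmeas : Measurable m)
    (hbdd : ∃ C : ℝ, ∀ x : ℝ, |m x| ≤ C)
    (heq : ∀ h : ℝ,
      ∫ x : ℝ, m x * ((2 * Real.pi) ^ (-(1 : ℝ) / 2) * Real.exp (-(x - h) ^ 2 / 2)) =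
        Real.exp (-h ^ 2 / 4)) :
    ∀ᵐ x : ℝ, m x = Real.sqrt 2 * Real.exp (-x ^ 2 / 2) := by
  obtain ⟨C, hC⟩ := hbdd
  have hC0 : 0 ≤ C := (abs_nonneg _).trans (hC 0)
  have hgle : ∀ x : ℝ, √2 * exp (-x ^ 2 / 2) ≤ √2 := fun x =>
    mul_le_of_le_one_right (sqrt_nonneg 2) (exp_le_one_iff.mpr (by nlinarith [sq_nonneg x]))
  have hshift : ∀ u : ℝ → ℝ, Measurable u → (∃ B : ℝ, ∀ x, |u x| ≤ B) → ∀ t : ℝ,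
      ∫ x, (u x + C) * ((2 * π) ^ (-(1 : ℝ) / 2) * exp (-(x - t) ^ 2 / 2)) =
        (∫ x, u x * ((2 * π) ^ (-(1 : ℝ) / 2) * exp (-(x - t) ^ 2 / 2))) +
          ∫ x, C * ((2 * π) ^ (-(1 : ℝ) / 2) * exp (-(x - t) ^ 2 / 2)) :=
    fun u hu ⟨B, hB⟩ t => by
      simp_rw [add_mul]
      exact integral_add ((integrable_exp_neg_sub_sq_div_two t).bdd_mul
        hu.aestronglyMeasurable (.of_forall hB))
        ((integrable_exp_neg_sub_sq_div_two t).const_mul C)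
  have hae := ae_eq_gaussianReal_of_integral_exp_eq (f := fun x => m x + C)
    (g := fun x => √2 * exp (-x ^ 2 / 2) + C) (K := C + √2 + C)
    (by fun_prop) (by fun_prop)
    (fun x => by linarith [(abs_le.mp (hC x)).1])
    (fun x => by positivity)
    (fun x => by linarith [(abs_le.mp (hC x)).2, sqrt_nonneg 2])
    (fun x => by linarith [hgle x])
    (fun t => by
      rw [integral_mul_exp_gaussianReal, integral_mul_exp_gaussianReal, hshift m hmeas ⟨C, hC⟩,
        hshift _ (by fun_prop) ⟨√2, fun x => by rw [abs_of_nonneg (by positivity)]; exact hgle x⟩,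
        heq, integral_sqrt_two_mul_exp_mul_gaussian])
  filter_upwards [(ProbabilityTheory.gaussianReal_absolutelyContinuous' 0 one_ne_zero).ae_le hae]
    with x hx
  exact add_right_cancel hx
end

section
/- Contiguity lemma (Lemma A.1). For each n ∈ ℕ let P_n and Q_n be probability measures on a measurable space Ω_n, and assume Q_n is contiguous with respect to P_n, i.e., for every sequence of measurable sets A_n ⊆ Ω_n, P_n(A_n) → 0 implies Q_n(A_n) → 0. Then for every sequence of measurable sets F_n ⊆ Ω_n, lim_{n→∞} ( Q_n(F_n) − ∫_{F_n} (dQ_n/dP_n) dP_n ) = 0, where dQ_n/dP_n denotes the Radon–Nikodym derivative of (the absolutely continuous part of) Q_n with respect to P_n. In particular, lim_n Q_n(F_n) = lim_n ∫_{F_n} (dQ_n/dP_n) dP_n provided either limit exists. -/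
open MeasureTheory Filter

/-- A measure minus the integral of its Radon–Nikodym derivative is its singular part. -/
theorem measure_toReal_sub_setIntegral_rnDeriv {α : Type*} [MeasurableSpace α] (μ ν : Measure α)
    [IsFiniteMeasure μ] [SigmaFinite ν] (s : Set α) :
    (μ s).toReal - ∫ x in s, (μ.rnDeriv ν x).toReal ∂ν = (μ.singularPart ν s).toReal := by
  have hint : ∫ x in s, (μ.rnDeriv ν x).toReal ∂ν = (ν.withDensity (μ.rnDeriv ν) s).toReal :=
    Measure.setIntegral_toReal_rnDeriv_eq_withDensity s
  have hadd : μ s = μ.singularPart ν s + ν.withDensity (μ.rnDeriv ν) s := by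
    conv_lhs => rw [← μ.singularPart_add_rnDeriv ν, Measure.add_apply]
  rw [hint, hadd, ENNReal.toReal_add (measure_ne_top _ _) (measure_ne_top _ _), add_sub_cancel_right]

/-- **Contiguity lemma** (Lemma A.1). If `Q n` is contiguous with respect to `P n`, then for
every sequence of measurable sets `F n`, the difference between `Q n (F n)` and
`∫_{F n} (dQ_n/dP_n) dP_n` tends to zero. -/
theorem contiguity_lemma (Ω : ℕ → Type*) [∀ n, MeasurableSpace (Ω n)]
    (P Q : ∀ n, Measure (Ω n))
    [∀ n, IsProbabilityMeasure (P n)] [∀ n, IsProbabilityMeasure (Q n)]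
    (hcontig : ∀ A : ∀ n, Set (Ω n), (∀ n, MeasurableSet (A n)) →
      Tendsto (fun n => P n (A n)) atTop (nhds 0) →
      Tendsto (fun n => Q n (A n)) atTop (nhds 0))
    (F : ∀ n, Set (Ω n)) (hF : ∀ n, MeasurableSet (F n)) :
    Tendsto
      (fun n => (Q n (F n)).toReal -
        ∫ ω in F n, ((Q n).rnDeriv (P n) ω).toReal ∂(P n))
      atTop (nhds 0) := by
  simp_rw [measure_toReal_sub_setIntegral_rnDeriv]
  have hs (n) := (Q n).mutuallySingular_singularPart (P n)
  have hQ := hcontig (fun n => (hs n).nullSetᶜ) (fun n => (hs n).measurableSet_nullSet.compl)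
    (by simp)
  have hle (n) : (Q n).singularPart (P n) (F n) ≤ Q n (hs n).nullSetᶜ :=
    calc (Q n).singularPart (P n) (F n)
        ≤ (Q n).singularPart (P n) Set.univ := measure_mono (Set.subset_univ _)
      _ = (Q n).singularPart (P n) (hs n).nullSetᶜ := by
        rw [← measure_add_measure_compl (hs n).measurableSet_nullSet,
          (hs n).measure_nullSet, zero_add]
      _ ≤ Q n (hs n).nullSetᶜ := Measure.singularPart_le _ _ _
  exact (ENNReal.tendsto_toReal_zero_iff fun _ => measure_ne_top _ _).2
    (tendsto_of_tendsto_of_tendsto_of_le_of_le tendsto_const_nhds hQ (fun _ => zero_le) hle)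
end
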